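/- Let m(n) denote the maximum sort-number of permutations of length n under SC_231. Then m(n) ≥ n-1 for all n ≥ 3. -/

import Mathlib

/-- One step-by-step implementation of the `SC_231` stack-sorting machine.
`sc231Aux input stack out`: the next input entry is pushed onto the stack unless
pushing it would create a consecutive occurrence of the pattern `231` read from
top to bottom among the stack entries (i.e. the incoming `x` on top of `y`, `z`
with `z < x < y`), in which case the top of the stack is popped and appended to
the output; once the input is exhausted the remaining stack entries are popped. -/
def sc231Aux : List ℕ → List ℕ → List ℕ → List ℕ
  | [], stack, out => out ++ stack
  | x :: rest, y :: z :: s, out =>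
      if z < x ∧ x < y then sc231Aux (x :: rest) (z :: s) (out ++ [y])
      else sc231Aux rest (x :: y :: z :: s) out
  | x :: rest, stack, out => sc231Aux rest (x :: stack) out
termination_by input stack _ => 2 * input.length + stack.length
decreasing_by all_goals (simp; try omega)

/-- The consecutive-pattern-avoiding stack sort map `SC_231`. -/
def SC231 (p : List ℕ) : List ℕ := sc231Aux p [] []

/-- The list of entries that are *pre-popped* while `SC_231` processes the
input, i.e. popped while input entries still remain. -/
def prePopsAux : List ℕ → List ℕ → List ℕ
  | [], _ => []
  | x :: rest, y :: z :: s =>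
      if z < x ∧ x < y then y :: prePopsAux (x :: rest) (z :: s)
      else prePopsAux rest (x :: y :: z :: s)
  | x :: rest, stack => prePopsAux rest (x :: stack)
termination_by input stack => 2 * input.length + stack.length
decreasing_by all_goals (simp; try omega)

def prePops (p : List ℕ) : List ℕ := prePopsAux p []

/-- `p` has a peak: an interior position whose entry exceeds both neighbours. -/
def HasPeak (p : List ℕ) : Prop :=
  ∃ i, i + 2 < p.length ∧ p[i]! < p[i+1]! ∧ p[i+2]! < p[i+1]!

/-- `p` is a permutation of `{1, …, n}` (written as a list of its entries). -/
def IsPermOf (n : ℕ) (p : List ℕ) : Prop := p.Perm (List.range' 1 n)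

/-- `p` contains the (classical) pattern `q`. -/
def ContainsPat (p q : List ℕ) : Prop :=
  ∃ s : List ℕ, s.Sublist p ∧ s.length = q.length ∧
    ∀ i j, i < s.length → j < s.length → (s[i]! < s[j]! ↔ q[i]! < q[j]!)

def AvoidsPat (p q : List ℕ) : Prop := ¬ ContainsPat p q

/-- The sort-number of `p`: the least `k` with `SC_231^k(p)` peakless. -/
noncomputable def sortNum (p : List ℕ) : ℕ := sInf {k | ¬ HasPeak (SC231^[k] p)}

/-! ### Single steps of the machine -/

/-- `x` may be pushed onto `st` without creating a consecutive `231` at its top. -/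
def CanPush (x : ℕ) (st : List ℕ) : Prop :=
  ∀ y z s, st = y :: z :: s → ¬ (z < x ∧ x < y)

theorem sc231Aux_nil (st out : List ℕ) : sc231Aux [] st out = out ++ st := by
  rw [sc231Aux]

theorem sc231Aux_pop {x y z : ℕ} (rest s out : List ℕ) (h₁ : z < x) (h₂ : x < y) :
    sc231Aux (x :: rest) (y :: z :: s) out = sc231Aux (x :: rest) (z :: s) (out ++ [y]) := by
  rw [sc231Aux, if_pos ⟨h₁, h₂⟩]

theorem sc231Aux_push {x : ℕ} {st : List ℕ} (h : CanPush x st) (rest out : List ℕ) :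
    sc231Aux (x :: rest) st out = sc231Aux rest (x :: st) out := by
  match st with
  | [] => simp [sc231Aux]
  | [a] => simp [sc231Aux]
  | y :: z :: s => rw [sc231Aux, if_neg (h y z s rfl)]

theorem prePopsAux_nil (st : List ℕ) : prePopsAux [] st = [] := by
  rw [prePopsAux]

theorem prePopsAux_pop {x y z : ℕ} (rest s : List ℕ) (h₁ : z < x) (h₂ : x < y) :
    prePopsAux (x :: rest) (y :: z :: s) = y :: prePopsAux (x :: rest) (z :: s) := by
  rw [prePopsAux, if_pos ⟨h₁, h₂⟩]

theorem prePopsAux_push {x : ℕ} {st : List ℕ} (h : CanPush x st) (rest : List ℕ) :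
    prePopsAux (x :: rest) st = prePopsAux rest (x :: st) := by
  match st with
  | [] => simp [prePopsAux]
  | [a] => simp [prePopsAux]
  | y :: z :: s => rw [prePopsAux, if_neg (h y z s rfl)]

/-- Induction along the run of the machine. -/
theorem stack_induction {P : List ℕ → List ℕ → Prop} (nil : ∀ st, P [] st)
    (pop : ∀ x rest y z s, z < x → x < y → P (x :: rest) (z :: s) → P (x :: rest) (y :: z :: s))
    (push : ∀ x rest st, CanPush x st → P rest (x :: st) → P (x :: rest) st)
    (input st : List ℕ) : P input st := by
  induction input generalizing st with
  | nil => exact nil st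
  | cons x rest ih =>
    induction st with
    | nil => exact push _ _ _ (by simp [CanPush]) (ih _)
    | cons y s ihs =>
      by_cases h : CanPush x (y :: s)
      · exact push _ _ _ h (ih _)
      · simp only [CanPush, not_forall, not_not] at h
        obtain ⟨_, z, s', heq, h₁, h₂⟩ := h
        obtain ⟨rfl, rfl⟩ := List.cons.inj heq
        exact pop _ _ _ _ _ h₁ h₂ ihs

/-! ### General properties of `SC231` -/

theorem sc231Aux_perm (input st out : List ℕ) :
    (sc231Aux input st out).Perm (input ++ st ++ out) := by
  refine stack_induction (P := fun input st => ∀ out,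
    (sc231Aux input st out).Perm (input ++ st ++ out)) ?_ ?_ ?_ input st out
  · intro st out
    rw [sc231Aux_nil]
    exact List.perm_append_comm
  · intro x rest y z s h₁ h₂ ih out
    rw [sc231Aux_pop _ _ _ h₁ h₂]
    refine (ih _).trans ?_
    rw [List.perm_iff_count]
    intro a
    simp only [List.count_append, List.count_cons, List.count_nil]
    omega
  · intro x rest st h ih out
    rw [sc231Aux_push h]
    refine (ih _).trans ?_
    rw [List.perm_iff_count]
    intro a
    simp only [List.count_append, List.count_cons]
    omega

theorem SC231_perm (p : List ℕ) : (SC231 p).Perm p := by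
  simpa [SC231] using sc231Aux_perm p [] []

theorem SC231_iterate_perm (p : List ℕ) (k : ℕ) : (SC231^[k] p).Perm p := by
  induction k with
  | zero => rfl
  | succ k ih =>
    rw [Function.iterate_succ_apply']
    exact (SC231_perm _).trans ih

theorem prePopsAux_isPrefix (input st out : List ℕ) :
    out ++ prePopsAux input st <+: sc231Aux input st out := by
  refine stack_induction (P := fun input st => ∀ out,
    out ++ prePopsAux input st <+: sc231Aux input st out) ?_ ?_ ?_ input st out
  · intro st out
    simp [sc231Aux_nil, prePopsAux_nil]
  · intro x rest y z s h₁ h₂ ih out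
    rw [sc231Aux_pop _ _ _ h₁ h₂, prePopsAux_pop _ _ h₁ h₂]
    simpa using ih (out ++ [y])
  · intro x rest st h ih out
    rw [sc231Aux_push h, prePopsAux_push h]
    exact ih out

theorem prePops_isPrefix (p : List ℕ) : prePops p <+: SC231 p := by
  exact prePopsAux_isPrefix p [] []

theorem filter_sc231Aux (q : ℕ → Bool) (input st out : List ℕ)
    (hq : ∀ y ∈ prePopsAux input st, q y = false) :
    (sc231Aux input st out).filter q = (out ++ input.reverse ++ st).filter q := by
  refine stack_induction (P := fun input st => ∀ out,
    (∀ y ∈ prePopsAux input st, q y = false) →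
    (sc231Aux input st out).filter q = (out ++ input.reverse ++ st).filter q)
    ?_ ?_ ?_ input st out hq
  · intro st out _
    simp [sc231Aux_nil]
  · intro x rest y z s h₁ h₂ ih out hq
    rw [prePopsAux_pop _ _ h₁ h₂] at hq
    rw [sc231Aux_pop _ _ _ h₁ h₂, ih _ fun w hw => hq w (List.mem_cons_of_mem _ hw)]
    simp [List.filter_cons, hq y List.mem_cons_self]
  · intro x rest st h ih out hq
    rw [prePopsAux_push h] at hq
    rw [sc231Aux_push h, ih _ hq]
    simp

/-- If no entry selected by `q` is pre-popped, `SC231` reverses the selected entries. -/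
theorem filter_SC231 (q : ℕ → Bool) (p : List ℕ) (hq : ∀ y ∈ prePops p, q y = false) :
    (SC231 p).filter q = (p.filter q).reverse := by
  simpa [SC231] using filter_sc231Aux q p [] [] hq

theorem exists_sublist_of_mem_prePopsAux {y : ℕ} (input st : List ℕ)
    (hy : y ∈ prePopsAux input st) :
    ∃ z x, z < y ∧ x < y ∧ [z, y, x].Sublist (st.reverse ++ input) := by
  revert hy
  refine stack_induction (P := fun input st => y ∈ prePopsAux input st →
    ∃ z x, z < y ∧ x < y ∧ [z, y, x].Sublist (st.reverse ++ input)) ?_ ?_ ?_ input st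
  · intro st hy
    simp [prePopsAux_nil] at hy
  · intro x rest w z s h₁ h₂ ih hy
    rw [prePopsAux_pop _ _ h₁ h₂, List.mem_cons] at hy
    rcases hy with rfl | hy
    · exact ⟨z, x, h₁.trans h₂, h₂, by simp⟩
    · obtain ⟨z', x', hz, hx, hs⟩ := ih hy
      refine ⟨z', x', hz, hx, hs.trans ?_⟩
      simp
  · intro x rest st h ih hy
    rw [prePopsAux_push h] at hy
    simpa using ih hy

theorem exists_sublist_of_mem_prePops {y : ℕ} {p : List ℕ} (hy : y ∈ prePops p) :
    ∃ z x, z < y ∧ x < y ∧ [z, y, x].Sublist p := by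
  simpa using exists_sublist_of_mem_prePopsAux p [] hy

theorem prePopsAux_eq_nil_of_append (l r st : List ℕ) (h : prePopsAux (l ++ r) st = []) :
    prePopsAux r (l.reverse ++ st) = [] := by
  induction l generalizing st with
  | nil => simpa using h
  | cons x l ih =>
    by_cases hx : CanPush x st
    · rw [List.cons_append, prePopsAux_push hx] at h
      simpa using ih _ h
    · simp only [CanPush, not_forall, not_not] at hx
      obtain ⟨y, z, s, rfl, h₁, h₂⟩ := hx
      rw [List.cons_append, prePopsAux_pop _ _ h₁ h₂] at h
      simp at h

theorem prePops_ne_nil {z y x : ℕ} (l r : List ℕ) (h₁ : z < x) (h₂ : x < y) :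
    prePops (l ++ z :: y :: x :: r) ≠ [] := by
  intro h
  have := prePopsAux_eq_nil_of_append (l ++ [z, y]) (x :: r) [] (by simpa [prePops] using h)
  rw [show (l ++ [z, y]).reverse ++ [] = y :: z :: l.reverse by simp,
    prePopsAux_pop _ _ h₁ h₂] at this
  simp at this

/-! ### Peaks -/

theorem hasPeak_append {z y x : ℕ} (l r : List ℕ) (h₁ : z < y) (h₂ : x < y) :
    HasPeak (l ++ z :: y :: x :: r) :=
  ⟨l.length, by simp, by simpa [List.getElem!_eq_getElem?_getD, List.getElem?_append] using h₁,
    by simpa [List.getElem!_eq_getElem?_getD, List.getElem?_append] using h₂⟩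

theorem HasPeak.exists_eq_append {p : List ℕ} (h : HasPeak p) :
    ∃ l z y x r, p = l ++ z :: y :: x :: r ∧ z < y ∧ x < y := by
  obtain ⟨i, hi, h₁, h₂⟩ := h
  rw [getElem!_pos p i (by omega), getElem!_pos p (i + 1) (by omega)] at h₁
  rw [getElem!_pos p (i + 2) (by omega), getElem!_pos p (i + 1) (by omega)] at h₂
  refine ⟨p.take i, _, _, _, p.drop (i + 3), ?_, h₁, h₂⟩
  rw [← List.drop_eq_getElem_cons, ← List.drop_eq_getElem_cons, ← List.drop_eq_getElem_cons,
    List.take_append_drop]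

/-! ### Every permutation is eventually peakless -/

/-- An entry that is extremal in position among the entries not exceeding it is not pre-popped. -/
theorem not_mem_prePops_of_extreme {m : ℕ} {p : List ℕ} (hp : p.Nodup)
    (h : (p.filter (· ≤ m)).head? = some m ∨ (p.filter (· ≤ m)).getLast? = some m) :
    m ∉ prePops p := by
  intro hm
  obtain ⟨z, x, hz, hx, hs⟩ := exists_sublist_of_mem_prePops hm
  have hs' := hs.filter (· ≤ m)
  rw [List.filter_eq_self.2 (by simp [hz.le, hx.le])] at hs'
  have hn : (p.filter (· ≤ m)).Nodup := hp.filter _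
  generalize p.filter (· ≤ m) = f at *
  rcases h with h | h
  · obtain ⟨t, rfl⟩ := List.head?_eq_some_iff.1 h
    rcases List.sublist_cons_iff.1 hs' with h' | ⟨r, hr, -⟩
    · exact (List.nodup_cons.1 hn).1 (h'.subset (by simp))
    · simp at hr
      omega
  · obtain ⟨t, rfl⟩ := List.getLast?_eq_some_iff.1 h
    have hs'' := hs'.reverse
    rw [← List.nodup_reverse] at hn
    simp only [List.reverse_append, List.reverse_cons, List.reverse_nil, List.nil_append,
      List.cons_append] at hs'' hn
    rcases List.sublist_cons_iff.1 hs'' with h' | ⟨r, hr, -⟩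
    · exact (List.nodup_cons.1 hn).1 (h'.subset (by simp))
    · simp at hr
      omega

/-- A pre-popped entry, no smaller entry being pre-popped, moves in front of all smaller ones. -/
theorem head?_filter_SC231 {m : ℕ} {p : List ℕ} (hlow : ∀ y ∈ prePops p, m ≤ y)
    (hm : m ∈ prePops p) : ((SC231 p).filter (· ≤ m)).head? = some m := by
  obtain ⟨t, ht⟩ := prePops_isPrefix p
  rw [← ht, List.filter_append]
  have hmem : m ∈ (prePops p).filter (· ≤ m) := by simp [hm]
  cases hf : (prePops p).filter (· ≤ m) with
  | nil => simp [hf] at hmem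
  | cons a f =>
    have ha : a ∈ (prePops p).filter (· ≤ m) := by simp [hf]
    rw [List.mem_filter] at ha
    have h₁ := hlow a ha.1
    have h₂ : a ≤ m := by simpa using ha.2
    simp
    omega

theorem eventually_lt_prePops {p : List ℕ} (hp : p.Nodup) (m : ℕ) :
    ∃ T, ∀ t ≥ T, ∀ y ∈ prePops (SC231^[t] p), m < y := by
  have hnodup (t : ℕ) : (SC231^[t] p).Nodup := (SC231_iterate_perm p t).nodup_iff.2 hp
  induction m with
  | zero =>
    refine ⟨0, fun t _ y hy => ?_⟩
    obtain ⟨z, x, hz, -⟩ := exists_sublist_of_mem_prePops hy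
    omega
  | succ m ih =>
    obtain ⟨T, hT⟩ := ih
    by_cases hpop : ∃ t ≥ T, m + 1 ∈ prePops (SC231^[t] p)
    · obtain ⟨t₀, ht₀, hm⟩ := hpop
      have hext (t : ℕ) (ht : t₀ + 1 ≤ t) :
          ((SC231^[t] p).filter (· ≤ m + 1)).head? = some (m + 1) ∨
          ((SC231^[t] p).filter (· ≤ m + 1)).getLast? = some (m + 1) := by
        induction t, ht using Nat.le_induction with
        | base =>
          left
          rw [Function.iterate_succ_apply']
          exact head?_filter_SC231 (hT t₀ ht₀) hm
        | succ t ht ih =>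
          have hnot := not_mem_prePops_of_extreme (hnodup t) ih
          rw [Function.iterate_succ_apply', filter_SC231, List.head?_reverse,
            List.getLast?_reverse]
          · exact ih.symm
          · intro y hy
            have := hT t (by omega) y hy
            have : y ≠ m + 1 := fun h => hnot (h ▸ hy)
            simp
            omega
      refine ⟨t₀ + 1, fun t ht y hy => ?_⟩
      have := hT t (by omega) y hy
      have : y ≠ m + 1 := fun h =>
        not_mem_prePops_of_extreme (hnodup t) (hext t ht) (h ▸ hy)
      omega
    · refine ⟨T, fun t ht y hy => ?_⟩
      have := hT t ht y hy
      have : y ≠ m + 1 := fun h => hpop ⟨t, ht, h ▸ hy⟩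
      omega

theorem exists_not_hasPeak {p : List ℕ} (hp : p.Nodup) : ∃ k, ¬ HasPeak (SC231^[k] p) := by
  obtain ⟨T, hT⟩ := eventually_lt_prePops hp p.sum
  have hnil (t : ℕ) (ht : T ≤ t) : prePops (SC231^[t] p) = [] := by
    rw [List.eq_nil_iff_forall_not_mem]
    intro y hy
    obtain ⟨z, x, -, -, hs⟩ := exists_sublist_of_mem_prePops hy
    have hmem : y ∈ p := (SC231_iterate_perm p t).subset (hs.subset (by simp))
    exact (hT t ht y hy).not_ge (List.le_sum_of_mem hmem)
  refine ⟨T, fun hpeak => ?_⟩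
  have h₀ := hnil T le_rfl
  have h₁ := hnil (T + 1) (by omega)
  have hrev := filter_SC231 (fun _ => true) (SC231^[T] p) (by simp [h₀])
  rw [List.filter_true, List.filter_true] at hrev
  rw [Function.iterate_succ_apply', hrev] at h₁
  have hn : (SC231^[T] p).Nodup := (SC231_iterate_perm p T).nodup_iff.2 hp
  obtain ⟨l, z, y, x, r, heq, hz, hx⟩ := hpeak.exists_eq_append
  rw [heq] at h₀ h₁ hn
  have hne : z ≠ x := by
    have := (List.nodup_append.1 hn).2.1
    simp at this
    tauto
  rcases hne.lt_or_gt with h | h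
  · exact prePops_ne_nil l r h hx h₀
  · exact prePops_ne_nil r.reverse l.reverse h hz (by simpa using h₁)

/-! ### The permutation `V_n` -/

/-- The positive numbers up to `m` of the parity of `m`, in decreasing order. -/
def parityDesc : ℕ → List ℕ
  | 0 => []
  | 1 => [1]
  | m + 2 => (m + 2) :: parityDesc m

/-- The positive numbers up to `m` of the parity of `m`, in increasing order. -/
def parityAsc (m : ℕ) : List ℕ := (parityDesc m).reverse

/-- The permutation `V_m` (as `parityVee k` with `m = k + 1`). -/
def parityVee (k : ℕ) : List ℕ := parityAsc (k + 1) ++ parityDesc k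

theorem parityAsc_add_two (m : ℕ) : parityAsc (m + 2) = parityAsc m ++ [m + 2] := by
  simp [parityAsc, parityDesc]

theorem le_of_mem_parityDesc {m x : ℕ} (h : x ∈ parityDesc m) : x ≤ m := by
  induction m using Nat.twoStepInduction with
  | zero => simp [parityDesc] at h
  | one => simp [parityDesc] at h; omega
  | more m ih _ =>
    rw [parityDesc, List.mem_cons] at h
    rcases h with rfl | h
    · rfl
    · have := ih h
      omega

theorem le_of_mem_parityVee {k x : ℕ} (h : x ∈ parityVee k) : x ≤ k + 1 := by
  simp only [parityVee, parityAsc, List.mem_append, List.mem_reverse] at h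
  rcases h with h | h
  · exact le_of_mem_parityDesc h
  · exact (le_of_mem_parityDesc h).trans (by omega)

theorem pairwise_parityDesc (m : ℕ) : (parityDesc m).Pairwise (· > ·) := by
  induction m using Nat.twoStepInduction with
  | zero => simp [parityDesc]
  | one => simp [parityDesc]
  | more m ih _ =>
    rw [parityDesc, List.pairwise_cons]
    refine ⟨fun a ha => ?_, ih⟩
    have := le_of_mem_parityDesc ha
    omega

theorem pairwise_parityAsc (m : ℕ) : (parityAsc m).Pairwise (· < ·) :=
  List.pairwise_reverse.2 (pairwise_parityDesc m)

theorem parityVee_perm (k : ℕ) : (parityVee k).Perm (List.range' 1 (k + 1)) := by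
  induction k with
  | zero => simp [parityVee, parityAsc, parityDesc]
  | succ k ih =>
    rw [List.range'_concat]
    refine List.Perm.trans ?_ (ih.append_right _)
    rw [List.perm_iff_count]
    intro a
    simp only [parityVee, parityAsc, parityDesc, List.count_append, List.count_reverse,
      List.count_cons, List.count_nil, one_mul, show 1 + (k + 1) = k + 2 by omega]
    omega

/-! ### The orbit of the reverse of `V_n` -/

theorem sc231Aux_push_lt {l : List ℕ} {st : List ℕ} (hl : l.Pairwise (· < ·))
    (hst : ∀ a ∈ l, ∀ b ∈ st, a < b) (rest out : List ℕ) :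
    sc231Aux (l ++ rest) st out = sc231Aux rest (l.reverse ++ st) out := by
  have chain (l : List ℕ) (a : ℕ) (st : List ℕ) (hl : (a :: l).Pairwise (· < ·)) :
      sc231Aux (l ++ rest) (a :: st) out = sc231Aux rest (l.reverse ++ a :: st) out := by
    induction l generalizing a st with
    | nil => rfl
    | cons b l ih =>
      have hab : a < b := (List.pairwise_cons.1 hl).1 b (by simp)
      rw [List.cons_append, sc231Aux_push, ih _ _ (List.pairwise_cons.1 hl).2]
      · simp
      · intro y z s h
        simp at h
        omega
  cases l with
  | nil => rfl
  | cons a l =>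
    rw [List.cons_append, sc231Aux_push, chain _ _ _ hl]
    · simp
    · rintro y z s rfl
      have := hst a (by simp) z (by simp)
      omega

theorem sc231Aux_push_gt {l : List ℕ} {y z : ℕ} (hl : (y :: l).Pairwise (· > ·))
    (hz : ∀ a ∈ l, a ≤ z) (st rest out : List ℕ) :
    sc231Aux (l ++ rest) (y :: z :: st) out = sc231Aux rest (l.reverse ++ y :: z :: st) out := by
  induction l generalizing y z st with
  | nil => rfl
  | cons b l ih =>
    rw [List.pairwise_cons] at hl
    have hbz := hz b (by simp)
    rw [List.cons_append, sc231Aux_push, ih hl.2 fun a ha => (hl.1 a (by simp [ha])).le]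
    · simp
    · intro y' z' s h
      simp at h
      omega

theorem SC231_reverse_parityVee (k : ℕ) :
    SC231 (parityVee (k + 1)).reverse = parityVee (k + 1) := by
  have hrev : (parityVee (k + 1)).reverse =
      (parityAsc (k + 1) ++ [k + 2]) ++ (parityDesc k ++ []) := by
    simp [parityVee, parityAsc, parityDesc]
  have htop : ∃ s, parityDesc (k + 1) = (k + 1) :: s := by
    cases k <;> simp [parityDesc]
  obtain ⟨s, hs⟩ := htop
  rw [SC231, hrev, sc231Aux_push_lt _ (by simp)]
  · rw [show (parityAsc (k + 1) ++ [k + 2]).reverse ++ [] = (k + 2) :: (k + 1) :: s by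
      simp [parityAsc, hs], sc231Aux_push_gt, sc231Aux_nil]
    · simp [parityVee, parityAsc, parityDesc, hs]
    · exact pairwise_parityDesc (k + 2)
    · exact fun a ha => (le_of_mem_parityDesc ha).trans (by omega)
  · refine List.pairwise_append.2 ⟨pairwise_parityAsc _, by simp, fun a ha b hb => ?_⟩
    have := le_of_mem_parityDesc (List.mem_reverse.1 ha)
    simp at hb
    omega

theorem sc231Aux_parityVee {k : ℕ} {st : List ℕ} (hst : ∀ b ∈ st, k + 3 < b)
    (rest out : List ℕ) :
    sc231Aux (parityVee (k + 2) ++ rest) st out =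
      sc231Aux rest (parityVee (k + 1) ++ st) (out ++ [k + 3]) := by
  have htop : ∃ s, parityDesc (k + 1) = (k + 1) :: s := by
    cases k <;> simp [parityDesc]
  obtain ⟨s, hs⟩ := htop
  rw [parityVee, List.append_assoc, sc231Aux_push_lt (pairwise_parityAsc _)]
  · rw [show (parityAsc (k + 2 + 1)).reverse ++ st = (k + 3) :: (k + 1) :: (s ++ st) by
      simp [parityAsc, parityDesc, hs], parityDesc, List.cons_append,
      sc231Aux_pop _ _ _ (by omega) (by omega), sc231Aux_push, sc231Aux_push_gt]
    · simp [parityVee, parityAsc, parityDesc, hs]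
    · exact pairwise_parityDesc (k + 2)
    · exact fun a ha => (le_of_mem_parityDesc ha).trans (by omega)
    · intro y z s h
      simp at h
      omega
  · intro a ha b hb
    have := le_of_mem_parityDesc (List.mem_reverse.1 ha)
    have := hst b hb
    omega

theorem sc231Aux_append_of_forall {q : ℕ → Prop} (pre rest st out : List ℕ)
    (hpre : ∀ a ∈ pre, q a) (hst : ∀ a ∈ st, q a) (hout : ∀ a ∈ out, q a) :
    ∃ st' out', (∀ a ∈ st', q a) ∧ (∀ a ∈ out', q a) ∧
      sc231Aux (pre ++ rest) st out = sc231Aux rest st' out' := by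
  refine stack_induction (P := fun pre st => ∀ out, (∀ a ∈ pre, q a) → (∀ a ∈ st, q a) →
    (∀ a ∈ out, q a) → ∃ st' out', (∀ a ∈ st', q a) ∧ (∀ a ∈ out', q a) ∧
      sc231Aux (pre ++ rest) st out = sc231Aux rest st' out') ?_ ?_ ?_ pre st out hpre hst hout
  · intro st out _ hst hout
    exact ⟨st, out, hst, hout, rfl⟩
  · intro x l y z s h₁ h₂ ih out hpre hst hout
    rw [List.cons_append, sc231Aux_pop _ _ _ h₁ h₂]
    rw [List.forall_mem_cons] at hst
    exact ih _ hpre hst.2 (by simpa [or_imp, forall_and] using ⟨hout, hst.1⟩)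
  · intro x l st h ih out hpre hst hout
    rw [List.cons_append, sc231Aux_push h]
    rw [List.forall_mem_cons] at hpre
    exact ih _ hpre.2 (List.forall_mem_cons.2 ⟨hpre.1, hst⟩) hout

/-- A block of small entries on the stack survives while larger entries are processed. -/
theorem sc231Aux_block {m : ℕ} {B : List ℕ} (hB : ∀ b ∈ B, b ≤ m) (hne : B ≠ [])
    (input u st out : List ℕ) (hin : ∀ a ∈ input, m < a) (hu : ∀ a ∈ u, m < a)
    (hout : ∀ a ∈ out, m < a) :
    ∃ l, (∀ a ∈ l, m < a) ∧ sc231Aux input (u ++ (B ++ st)) out = l ++ (B ++ st) := by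
  obtain ⟨b, B, rfl⟩ := List.exists_cons_of_ne_nil hne
  induction input generalizing u out with
  | nil =>
    refine ⟨out ++ u, ?_, by simp [sc231Aux_nil]⟩
    simp only [List.mem_append]
    rintro a (h | h)
    exacts [hout a h, hu a h]
  | cons x rest ih =>
    rw [List.forall_mem_cons] at hin
    induction u generalizing out with
    | nil =>
      have hb := hB b (by simp)
      rw [sc231Aux_push]
      · exact ih [x] out hin.2 (by simpa using hin.1) hout
      · intro y z s h
        simp at h
        omega
    | cons c u ihu =>
      by_cases h : CanPush x (c :: u ++ (b :: B ++ st))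
      · rw [sc231Aux_push h]
        exact ih (x :: c :: u) out hin.2 (List.forall_mem_cons.2 ⟨hin.1, hu⟩) hout
      · simp only [CanPush, not_forall, not_not] at h
        obtain ⟨y, z, s, heq, h₁, h₂⟩ := h
        obtain ⟨rfl, hs⟩ := List.cons.inj heq
        rw [List.forall_mem_cons] at hu
        rw [heq, sc231Aux_pop _ _ _ h₁ h₂, ← hs]
        exact ihu _ hu.2 (by simpa [or_imp, forall_and] using ⟨hout, hu.1⟩)

/-- `p` consists of the block `V_(k+1)` surrounded by larger entries. -/
def HasVeeCore (k : ℕ) (p : List ℕ) : Prop :=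
  ∃ l r, p = l ++ (parityVee k ++ r) ∧ (∀ a ∈ l, k + 1 < a) ∧ ∀ a ∈ r, k + 1 < a

theorem HasVeeCore.step {k : ℕ} {p : List ℕ} (h : HasVeeCore (k + 2) p) :
    HasVeeCore (k + 1) (SC231 p) := by
  obtain ⟨l, r, rfl, hl, hr⟩ := h
  obtain ⟨st, out, hst, hout, heq⟩ := sc231Aux_append_of_forall (q := (k + 2 + 1 < ·)) l
    (parityVee (k + 2) ++ r) [] [] hl (by simp) (by simp)
  obtain ⟨l', hl', heq'⟩ := sc231Aux_block (m := k + 2) (B := parityVee (k + 1))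
    (fun b hb => le_of_mem_parityVee hb) (by simp [parityVee, parityAsc, parityDesc]) r [] st
    (out ++ [k + 3]) (fun a ha => (hr a ha).trans' (by omega)) (by simp) (by
      simp only [List.mem_append, List.mem_singleton]
      rintro a (h | rfl)
      · exact (hout a h).trans' (by omega)
      · omega)
  refine ⟨l', st, ?_, hl', fun a ha => (hst a ha).trans' (by omega)⟩
  rw [SC231, heq, sc231Aux_parityVee hst, ← heq', List.nil_append]

theorem HasVeeCore.hasPeak {k : ℕ} {p : List ℕ} (h : HasVeeCore (k + 2) p) : HasPeak p := by
  obtain ⟨l, r, rfl, -⟩ := h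
  have htop : ∃ s, parityAsc (k + 1) = s ++ [k + 1] := by
    cases k with
    | zero => exact ⟨[], rfl⟩
    | succ k => exact ⟨_, parityAsc_add_two k⟩
  obtain ⟨s, hs⟩ := htop
  rw [show l ++ (parityVee (k + 2) ++ r) =
    (l ++ s) ++ (k + 1) :: (k + 3) :: (k + 2) :: (parityDesc k ++ r) by
      simp [parityVee, parityAsc_add_two (k + 1), hs, parityDesc]]
  exact hasPeak_append _ _ (by omega) (by omega)

theorem hasVeeCore_iterate (i j : ℕ) :
    HasVeeCore (j + 1) (SC231^[i + 1] (parityVee (i + j + 1)).reverse) := by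
  have key (i k : ℕ) (p : List ℕ) (h : HasVeeCore (i + k + 1) p) :
      HasVeeCore (k + 1) (SC231^[i] p) := by
    induction i generalizing p with
    | zero => simpa using h
    | succ i ih =>
      rw [Function.iterate_succ_apply]
      exact ih _ (HasVeeCore.step (by convert h using 1; omega))
  rw [Function.iterate_succ_apply, SC231_reverse_parityVee]
  exact key i j _ ⟨[], [], by simp⟩

theorem hasPeak_reverse_parityVee (k : ℕ) : HasPeak (parityVee (k + 2)).reverse := by
  have htop : ∃ s, parityAsc (k + 2) = s ++ [k + 2] := ⟨_, parityAsc_add_two k⟩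
  obtain ⟨s, hs⟩ := htop
  have hd : ∃ s, parityDesc (k + 1) = (k + 1) :: s := by
    cases k <;> simp [parityDesc]
  obtain ⟨s', hs'⟩ := hd
  rw [show (parityVee (k + 2)).reverse = s ++ (k + 2) :: (k + 3) :: (k + 1) :: s' by
    rw [parityVee, List.reverse_append, ← parityAsc, hs, parityAsc, List.reverse_reverse,
      parityDesc, hs']
    simp]
  exact hasPeak_append _ _ (by omega) (by omega)

/-- The maximum sort-number of a length-`n` permutation under `SC_231` is at least `n - 1`
for `n ≥ 3`. -/
theorem sortNum_lower_bound (n : ℕ) (hn : 3 ≤ n) :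
    ∃ p : List ℕ, IsPermOf n p ∧ n - 1 ≤ sortNum p := by
  obtain ⟨k, rfl⟩ := Nat.exists_eq_add_of_le' hn
  have hperm : IsPermOf (k + 3) (parityVee (k + 2)).reverse :=
    (List.reverse_perm _).trans (parityVee_perm (k + 2))
  refine ⟨_, hperm, le_csInf (exists_not_hasPeak (hperm.nodup_iff.2 List.nodup_range')) ?_⟩
  intro t ht
  by_contra! hlt
  refine ht ?_
  cases t with
  | zero => exact hasPeak_reverse_parityVee k
  | succ t =>
    obtain ⟨j, rfl⟩ : ∃ j, k = t + j := Nat.exists_eq_add_of_le (by omega)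
    exact HasVeeCore.hasPeak (hasVeeCore_iterate t (j + 1))
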